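/- arXiv:1209.1009 — 4 statements merged into one kernel-verified Lean document; each statement's English description precedes it below -/
import Mathlib

section
/- For every real t with −17/10 ≤ t ≤ 0, one has |g₀''(t) − 6·g₀(t)² − t| < 1/8619, where g₀ is the explicit degree-7 polynomial given in the context. -/
/-- The explicit degree-7 polynomial approximation `g₀` of the (rotated) tritronquée on
`[−17/10, 0]`, written in the variable `s = t + 17/10`. -/
noncomputable def g0 (t : ℝ) : ℝ :=
  -280 / 519 + (150 / 1013) * (t + 17 / 10) + (239 / 10331) * (t + 17 / 10) ^ 2
    + (110 / 14779) * (t + 17 / 10) ^ 3 - (32 / 9853) * (t + 17 / 10) ^ 4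
    + (9 / 4397) * (t + 17 / 10) ^ 5 - (16 / 39505) * (t + 17 / 10) ^ 6
    + (8 / 49105) * (t + 17 / 10) ^ 7

/-- The second derivative of `g0`, as an explicit polynomial in `t + 17 / 10`. -/
lemma deriv_deriv_g0 (t : ℝ) :
    deriv (deriv g0) t = 478 / 10331 + (660 / 14779) * (t + 17 / 10)
      - (384 / 9853) * (t + 17 / 10) ^ 2 + (180 / 4397) * (t + 17 / 10) ^ 3
      - (480 / 39505) * (t + 17 / 10) ^ 4 + (336 / 49105) * (t + 17 / 10) ^ 5 := by
  have hs (x : ℝ) : HasDerivAt (fun y : ℝ => y + 17 / 10) 1 x := (hasDerivAt_id x).add_const _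
  have hpow (c : ℝ) (n : ℕ) (x : ℝ) : HasDerivAt (fun y : ℝ => c * (y + 17 / 10) ^ n)
      (c * (n * (x + 17 / 10) ^ (n - 1) * 1)) x := ((hs x).pow n).const_mul c
  have h₁ : deriv g0 = fun x => 150 / 1013 + (478 / 10331) * (x + 17 / 10)
      + (330 / 14779) * (x + 17 / 10) ^ 2 - (128 / 9853) * (x + 17 / 10) ^ 3
      + (45 / 4397) * (x + 17 / 10) ^ 4 - (96 / 39505) * (x + 17 / 10) ^ 5
      + (56 / 49105) * (x + 17 / 10) ^ 6 := by
    funext x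
    refine HasDerivAt.deriv ((((((((((hs x).const_mul (150 / 1013)).const_add (-280 / 519)).add
      (hpow (239 / 10331) 2 x)).add (hpow (110 / 14779) 3 x)).sub (hpow (32 / 9853) 4 x)).add
      (hpow (9 / 4397) 5 x)).sub (hpow (16 / 39505) 6 x)).add
      (hpow (8 / 49105) 7 x)).congr_deriv ?_)
    norm_num
    ring
  rw [h₁]
  refine HasDerivAt.deriv (((((((((hs t).const_mul (478 / 10331)).const_add (150 / 1013)).add
    (hpow (330 / 14779) 2 t)).sub (hpow (128 / 9853) 3 t)).add
    (hpow (45 / 4397) 4 t)).sub (hpow (96 / 39505) 5 t)).add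
    (hpow (56 / 49105) 6 t)).congr_deriv ?_)
  norm_num
  ring

/-- Products of nonnegative powers of `x` and `y` of total degree `14`, i.e. the Bernstein basis
of degree `14` up to scaling, are nonnegative. -/
lemma pow_mul_pow_fourteen_nonneg {x y : ℝ} (hx : 0 ≤ x) (hy : 0 ≤ y) (k : ℕ) :
    0 ≤ x ^ k * y ^ (14 - k) := by
  positivity

/-- The residual of `g0`, as a polynomial in `s = t + 17 / 10`. -/
noncomputable def residualPoly (s : ℝ) : ℝ :=
  478 / 10331 + (660 / 14779) * s - (384 / 9853) * s ^ 2 + (180 / 4397) * s ^ 3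
    - (480 / 39505) * s ^ 4 + (336 / 49105) * s ^ 5
    - 6 * (-280 / 519 + (150 / 1013) * s + (239 / 10331) * s ^ 2 + (110 / 14779) * s ^ 3
      - (32 / 9853) * s ^ 4 + (9 / 4397) * s ^ 5 - (16 / 39505) * s ^ 6
      + (8 / 49105) * s ^ 7) ^ 2 - (s - 17 / 10)

lemma abs_residualPoly_lt {s : ℝ} (h₀ : 0 ≤ s) (h₁ : s ≤ 17 / 10) :
    |residualPoly s| < 1 / 8619 := by
  have hcover : s ∈ Set.Icc 0 (17 / 40) ∨
      s ∈ Set.Icc (17 / 40) (17 / 20) ∨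
      s ∈ Set.Icc (17 / 20) (51 / 40) ∨
      s ∈ Set.Icc (51 / 40) (119 / 80) ∨
      s ∈ Set.Icc (119 / 80) (51 / 32) ∨
      s ∈ Set.Icc (51 / 32) (17 / 10) := by
    simp only [Set.mem_Icc]
    grind
  rcases hcover with hs | hs | hs | hs | hs | hs
  all_goals
    have h := pow_mul_pow_fourteen_nonneg (sub_nonneg.2 hs.1) (sub_nonneg.2 hs.2)
    rw [abs_lt, residualPoly]
    constructor <;>
      linarith [h 0, h 1, h 2, h 3, h 4, h 5, h 6, h 7,
        h 8, h 9, h 10, h 11, h 12, h 13, h 14]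

/-- **Proposition (residual bound).** For every `t ∈ [−17/10, 0]`,
`|g₀''(t) − 6 g₀(t)² − t| < 1/8619`. -/
theorem residual_bound :
    ∀ t ∈ Set.Icc (-17 / 10 : ℝ) 0,
      |deriv (deriv g0) t - 6 * (g0 t) ^ 2 - t| < 1 / 8619 := by
  intro t ht
  have h := abs_residualPoly_lt (s := t + 17 / 10) (by linarith [ht.1]) (by linarith [ht.2])
  rw [deriv_deriv_g0]
  convert h using 2
  rw [residualPoly, g0]
  ring
end

section
/- For every real t with −17/10 ≤ t ≤ 0, the following hold: |J₁(t)| ≤ 6/5, |J₂(t)| ≤ 3/7, |J₁'(t)| ≤ 5/2, |J₂'(t)| ≤ 21/20, |W(t) − 1| < 1/500 (so in particular W(t) ≠ 0), |J₁(t)/W(t)| ≤ 6/5, |J₂(t)/W(t)| ≤ 3/7, |(J₂(t)·J₁''(t) − J₁(t)·J₂''(t))/W(t)| < 1/1216, and |12·g₀(t) + (J₂''(t)·J₁'(t) − J₁''(t)·J₂'(t))/W(t)| < 1/492. -/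
/-- The approximate fundamental solution `J₁`, in the variable `s = t + 17/10`. -/
noncomputable def J1 (t : ℝ) : ℝ :=
  1 - (9489 / 2932) * (t + 17 / 10) ^ 2 + (1350 / 4721) * (t + 17 / 10) ^ 3
    + (359 / 199) * (t + 17 / 10) ^ 4 - (1526 / 3719) * (t + 17 / 10) ^ 5
    - (708 / 1633) * (t + 17 / 10) ^ 6 + (503 / 2201) * (t + 17 / 10) ^ 7
    - (211 / 6486) * (t + 17 / 10) ^ 8

/-- The approximate fundamental solution `J₂`, in the variable `s = t + 17/10`. -/
noncomputable def J2 (t : ℝ) : ℝ :=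
  (t + 17 / 10) - (48 / 659797) * (t + 17 / 10) ^ 2 - (2941 / 2730) * (t + 17 / 10) ^ 3
    + (675 / 4873) * (t + 17 / 10) ^ 4 + (1832 / 4745) * (t + 17 / 10) ^ 5
    - (2305 / 19401) * (t + 17 / 10) ^ 6 - (677 / 14054) * (t + 17 / 10) ^ 7
    + (1573 / 53783) * (t + 17 / 10) ^ 8 - (531 / 128216) * (t + 17 / 10) ^ 9

/-- The Wronskian `W = J₁ J₂' − J₂ J₁'`. -/
noncomputable def W (t : ℝ) : ℝ := J1 t * deriv J2 t - J2 t * deriv J1 t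

/-- The value at `x` of the polynomial whose coefficients, constant term first, are listed. -/
noncomputable def coeffEval : List ℚ → ℝ → ℝ
  | [], _ => 0
  | c :: p, x => c + x * coeffEval p x

/-- Coefficients of the sum of two polynomials. -/
def coeffAdd : List ℚ → List ℚ → List ℚ
  | [], q => q
  | a :: p, [] => a :: p
  | a :: p, b :: q => (a + b) :: coeffAdd p q

/-- Coefficients of a constant multiple of a polynomial. -/
def coeffScale (c : ℚ) : List ℚ → List ℚ
  | [] => []
  | a :: p => (c * a) :: coeffScale c p

/-- Coefficients of the product of two polynomials. -/
def coeffMul : List ℚ → List ℚ → List ℚ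
  | [], _ => []
  | a :: p, q => coeffAdd (coeffScale a q) (0 :: coeffMul p q)

/-- Coefficients of the derivative of a polynomial. -/
def coeffDeriv : List ℚ → List ℚ
  | [] => []
  | _ :: p => coeffAdd p (0 :: coeffDeriv p)

/-- Coefficients of `v ↦ p (m + h * v)`. -/
def coeffAffine (m h : ℚ) : List ℚ → List ℚ
  | [] => []
  | a :: p => coeffAdd [a] (coeffMul [m, h] (coeffAffine m h p))

/-- Sum of the absolute values of the coefficients. -/
def coeffNorm : List ℚ → ℚ
  | [] => 0
  | a :: p => |a| + coeffNorm p

/-- Certifies `|p| < c` on `[m - h, m + h]` by at most `n` levels of bisection, comparing `c`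
with the sum of the absolute Taylor coefficients on each piece. -/
def boundedOn (p : List ℚ) (c : ℚ) : ℕ → ℚ → ℚ → Bool
  | 0, m, h => decide (coeffNorm (coeffAffine m h p) < c)
  | n + 1, m, h => decide (coeffNorm (coeffAffine m h p) < c) ||
      (boundedOn p c n (m - h / 2) (h / 2) && boundedOn p c n (m + h / 2) (h / 2))

theorem coeffEval_add (p q : List ℚ) (x : ℝ) :
    coeffEval (coeffAdd p q) x = coeffEval p x + coeffEval q x := by
  induction p generalizing q with
  | nil => simp [coeffAdd, coeffEval]
  | cons a p ih =>
    cases q with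
    | nil => simp [coeffAdd, coeffEval]
    | cons b q => simp only [coeffAdd, coeffEval, ih]; push_cast; ring

theorem coeffEval_scale (c : ℚ) (p : List ℚ) (x : ℝ) :
    coeffEval (coeffScale c p) x = c * coeffEval p x := by
  induction p with
  | nil => simp [coeffScale, coeffEval]
  | cons a p ih => simp only [coeffScale, coeffEval, ih]; push_cast; ring

theorem coeffEval_mul (p q : List ℚ) (x : ℝ) :
    coeffEval (coeffMul p q) x = coeffEval p x * coeffEval q x := by
  induction p with
  | nil => simp [coeffMul, coeffEval]
  | cons a p ih =>
    simp only [coeffMul, coeffEval, coeffEval_add, coeffEval_scale, ih]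
    push_cast
    ring

theorem coeffEval_affine (m h : ℚ) (p : List ℚ) (v : ℝ) :
    coeffEval (coeffAffine m h p) v = coeffEval p (m + h * v) := by
  induction p with
  | nil => simp [coeffAffine, coeffEval]
  | cons a p ih =>
    simp only [coeffAffine, coeffEval, coeffEval_add, coeffEval_mul, ih]; ring

theorem hasDerivAt_coeffEval (p : List ℚ) (x : ℝ) :
    HasDerivAt (coeffEval p) (coeffEval (coeffDeriv p) x) x := by
  induction p with
  | nil => exact hasDerivAt_const x 0
  | cons a p ih =>
    have h := ((hasDerivAt_id x).mul ih).const_add (a : ℝ)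
    refine h.congr_deriv ?_
    simp [coeffDeriv, coeffEval, coeffEval_add]

theorem deriv_coeffEval_add_const (p : List ℚ) (a : ℝ) :
    deriv (fun t => coeffEval p (t + a)) = fun t => coeffEval (coeffDeriv p) (t + a) :=
  funext fun t => (hasDerivAt_coeffEval p (t + a)).comp_add_const t a |>.deriv

theorem abs_coeffEval_le_coeffNorm (p : List ℚ) {v : ℝ} (hv : |v| ≤ 1) :
    |coeffEval p v| ≤ coeffNorm p := by
  induction p with
  | nil => simp [coeffEval, coeffNorm]
  | cons a p ih =>
    simp only [coeffEval, coeffNorm]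
    push_cast
    calc |(a : ℝ) + v * coeffEval p v| ≤ |(a : ℝ)| + |v * coeffEval p v| := abs_add_le _ _
      _ ≤ |(a : ℝ)| + coeffNorm p := by
        rw [abs_mul]
        nlinarith [abs_nonneg (coeffEval p v), abs_nonneg v]

theorem abs_coeffEval_lt_of_coeffNorm {p : List ℚ} {c m h : ℚ} (hh : 0 < h)
    (hp : coeffNorm (coeffAffine m h p) < c) {x : ℝ} (hx : |x - m| ≤ h) :
    |coeffEval p x| < c := by
  have hh' : (0 : ℝ) < h := by exact_mod_cast hh
  have hv : |(x - m) / h| ≤ 1 := by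
    rw [abs_div, abs_of_pos hh']
    exact (div_le_one hh').2 hx
  have key := abs_coeffEval_le_coeffNorm (coeffAffine m h p) hv
  rw [coeffEval_affine, mul_div_cancel₀ _ hh'.ne', add_sub_cancel] at key
  exact key.trans_lt (by exact_mod_cast hp)

theorem abs_coeffEval_lt_of_boundedOn {p : List ℚ} {c : ℚ} {n : ℕ} {m h : ℚ} (hh : 0 < h)
    (hp : boundedOn p c n m h = true) {x : ℝ} (hx : |x - m| ≤ h) : |coeffEval p x| < c := by
  induction n generalizing m h with
  | zero => exact abs_coeffEval_lt_of_coeffNorm hh (by simpa [boundedOn] using hp) hx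
  | succ n ih =>
    simp only [boundedOn, Bool.or_eq_true, Bool.and_eq_true, decide_eq_true_eq] at hp
    rcases hp with hp | ⟨hl, hr⟩
    · exact abs_coeffEval_lt_of_coeffNorm hh hp hx
    · rw [abs_le] at hx
      rcases le_total x m with h' | h'
      · refine ih (half_pos hh) hl ?_
        push_cast
        rw [abs_le]
        constructor <;> linarith
      · refine ih (half_pos hh) hr ?_
        push_cast
        rw [abs_le]
        constructor <;> linarith

/-- Coefficients of `g0` in the variable `t + 17 / 10`. -/
def g0Coeff : List ℚ :=
  [-280 / 519, 150 / 1013, 239 / 10331, 110 / 14779, -32 / 9853, 9 / 4397, -16 / 39505,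
    8 / 49105]

/-- Coefficients of `J1` in the variable `t + 17 / 10`. -/
def J1Coeff : List ℚ :=
  [1, 0, -9489 / 2932, 1350 / 4721, 359 / 199, -1526 / 3719, -708 / 1633, 503 / 2201,
    -211 / 6486]

/-- Coefficients of `J2` in the variable `t + 17 / 10`. -/
def J2Coeff : List ℚ :=
  [0, 1, -48 / 659797, -2941 / 2730, 675 / 4873, 1832 / 4745, -2305 / 19401, -677 / 14054,
    1573 / 53783, -531 / 128216]

/-- Coefficients of `p * q - r * s`. -/
def coeffCross (p q r s : List ℚ) : List ℚ :=
  coeffAdd (coeffMul p q) (coeffScale (-1) (coeffMul r s))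

theorem coeffEval_cross (p q r s : List ℚ) (x : ℝ) :
    coeffEval (coeffCross p q r s) x =
      coeffEval p x * coeffEval q x - coeffEval r x * coeffEval s x := by
  simp only [coeffCross, coeffEval_add, coeffEval_mul, coeffEval_scale]
  push_cast
  ring

/-- Coefficients of `W` in the variable `t + 17 / 10`. -/
def WCoeff : List ℚ :=
  coeffCross J1Coeff (coeffDeriv J2Coeff) J2Coeff (coeffDeriv J1Coeff)

theorem g0_eq (t : ℝ) : g0 t = coeffEval g0Coeff (t + 17 / 10) := by
  simp only [g0, g0Coeff, coeffEval]
  push_cast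
  ring

theorem J1_eq : J1 = fun t => coeffEval J1Coeff (t + 17 / 10) := by
  funext t
  simp only [J1, J1Coeff, coeffEval]
  push_cast
  ring

theorem J2_eq : J2 = fun t => coeffEval J2Coeff (t + 17 / 10) := by
  funext t
  simp only [J2, J2Coeff, coeffEval]
  push_cast
  ring

theorem deriv_J1 : deriv J1 = fun t => coeffEval (coeffDeriv J1Coeff) (t + 17 / 10) := by
  rw [J1_eq, deriv_coeffEval_add_const]

theorem deriv_J2 : deriv J2 = fun t => coeffEval (coeffDeriv J2Coeff) (t + 17 / 10) := by
  rw [J2_eq, deriv_coeffEval_add_const]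

theorem deriv_deriv_J1 :
    deriv (deriv J1) = fun t => coeffEval (coeffDeriv (coeffDeriv J1Coeff)) (t + 17 / 10) := by
  rw [deriv_J1, deriv_coeffEval_add_const]

theorem deriv_deriv_J2 :
    deriv (deriv J2) = fun t => coeffEval (coeffDeriv (coeffDeriv J2Coeff)) (t + 17 / 10) := by
  rw [deriv_J2, deriv_coeffEval_add_const]

theorem W_eq (t : ℝ) : W t = coeffEval WCoeff (t + 17 / 10) := by
  rw [W, deriv_J1, deriv_J2, J1_eq, J2_eq, WCoeff, coeffEval_cross]

theorem abs_coeffEval_lt_of_boundedOn_Icc {p : List ℚ} {c : ℚ} {n : ℕ}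
    (hp : boundedOn p c n (17 / 20) (17 / 20) = true) {t : ℝ}
    (ht : t ∈ Set.Icc (-17 / 10 : ℝ) 0) : |coeffEval p (t + 17 / 10)| < c := by
  refine abs_coeffEval_lt_of_boundedOn (by norm_num) hp ?_
  push_cast
  rw [abs_le]
  constructor <;> linarith [ht.1, ht.2]

theorem abs_J1_lt {t : ℝ} (ht : t ∈ Set.Icc (-17 / 10 : ℝ) 0) : |J1 t| < 119 / 100 := by
  have h : boundedOn J1Coeff (119 / 100) 4 (17 / 20) (17 / 20) = true := by decide +kernel
  simpa [J1_eq] using abs_coeffEval_lt_of_boundedOn_Icc h ht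

theorem abs_J2_lt {t : ℝ} (ht : t ∈ Set.Icc (-17 / 10 : ℝ) 0) : |J2 t| < 21 / 50 := by
  have h : boundedOn J2Coeff (21 / 50) 4 (17 / 20) (17 / 20) = true := by decide +kernel
  simpa [J2_eq] using abs_coeffEval_lt_of_boundedOn_Icc h ht

theorem abs_deriv_J1_lt {t : ℝ} (ht : t ∈ Set.Icc (-17 / 10 : ℝ) 0) :
    |deriv J1 t| < 5 / 2 := by
  have h : boundedOn (coeffDeriv J1Coeff) (5 / 2) 4 (17 / 20) (17 / 20) = true := by
    decide +kernel
  simpa [deriv_J1] using abs_coeffEval_lt_of_boundedOn_Icc h ht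

theorem abs_deriv_J2_lt {t : ℝ} (ht : t ∈ Set.Icc (-17 / 10 : ℝ) 0) :
    |deriv J2 t| < 21 / 20 := by
  have h : boundedOn (coeffDeriv J2Coeff) (21 / 20) 4 (17 / 20) (17 / 20) = true := by
    decide +kernel
  simpa [deriv_J2] using abs_coeffEval_lt_of_boundedOn_Icc h ht

theorem abs_W_sub_one_lt {t : ℝ} (ht : t ∈ Set.Icc (-17 / 10 : ℝ) 0) :
    |W t - 1| < 1 / 500 := by
  have h : boundedOn (coeffAdd WCoeff [-1]) (1 / 500) 2 (17 / 20) (17 / 20) = true := by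
    decide +kernel
  have key := abs_coeffEval_lt_of_boundedOn_Icc h ht
  rw [coeffEval_add, ← W_eq] at key
  simpa [coeffEval, sub_eq_add_neg] using key

theorem abs_cross_deriv_deriv_lt {t : ℝ} (ht : t ∈ Set.Icc (-17 / 10 : ℝ) 0) :
    |J2 t * deriv (deriv J1) t - J1 t * deriv (deriv J2) t| < 1 / 1220 := by
  have h : boundedOn (coeffCross J2Coeff (coeffDeriv (coeffDeriv J1Coeff)) J1Coeff
      (coeffDeriv (coeffDeriv J2Coeff))) (1 / 1220) 5 (17 / 20) (17 / 20) = true := by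
    decide +kernel
  have key := abs_coeffEval_lt_of_boundedOn_Icc h ht
  rw [coeffEval_cross] at key
  rw [deriv_deriv_J1, deriv_deriv_J2, J1_eq, J2_eq]
  simpa using key

theorem abs_g0_mul_W_add_cross_lt {t : ℝ} (ht : t ∈ Set.Icc (-17 / 10 : ℝ) 0) :
    |12 * g0 t * W t + (deriv (deriv J2) t * deriv J1 t
      - deriv (deriv J1) t * deriv J2 t)| < 1 / 493 := by
  have h : boundedOn (coeffAdd (coeffMul (coeffScale 12 g0Coeff) WCoeff)
      (coeffCross (coeffDeriv (coeffDeriv J2Coeff)) (coeffDeriv J1Coeff)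
        (coeffDeriv (coeffDeriv J1Coeff)) (coeffDeriv J2Coeff)))
      (1 / 493) 7 (17 / 20) (17 / 20) = true := by
    decide +kernel
  have key := abs_coeffEval_lt_of_boundedOn_Icc h ht
  rw [coeffEval_add, coeffEval_mul, coeffEval_scale, coeffEval_cross, ← W_eq, ← g0_eq] at key
  rw [deriv_deriv_J1, deriv_deriv_J2, deriv_J1, deriv_J2]
  simpa using key

theorem abs_div_lt_of_abs_sub_one_lt {x w c : ℝ} (hc : 0 ≤ c) (hw : |w - 1| < 1 / 500)
    (hx : |x| < c * (499 / 500)) : |x / w| < c := by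
  have hw' : 499 / 500 < w := by linarith [(abs_lt.1 hw).1]
  have hpos : 0 < w := by linarith
  rw [abs_div, abs_of_pos hpos, div_lt_iff₀ hpos]
  exact hx.trans_le (mul_le_mul_of_nonneg_left hw'.le hc)

/-- **Proposition (estimates on the approximate fundamental system).** On `[−17/10, 0]`:
`|J₁| ≤ 6/5`, `|J₂| ≤ 3/7`, `|J₁'| ≤ 5/2`, `|J₂'| ≤ 21/20`, `|W − 1| < 1/500` (so
`W ≠ 0`), `|J₁/W| ≤ 6/5`, `|J₂/W| ≤ 3/7`, `|A| < 1/1216` and `|B₁| < 1/492`, where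
`A = (J₂ J₁'' − J₁ J₂'')/W` and `B₁ = 12 g₀ + (J₂'' J₁' − J₁'' J₂')/W`. -/
theorem fundamental_system_estimates :
    ∀ t ∈ Set.Icc (-17 / 10 : ℝ) 0,
      |J1 t| ≤ 6 / 5 ∧ |J2 t| ≤ 3 / 7 ∧ |deriv J1 t| ≤ 5 / 2 ∧ |deriv J2 t| ≤ 21 / 20 ∧
      |W t - 1| < 1 / 500 ∧ W t ≠ 0 ∧
      |J1 t / W t| ≤ 6 / 5 ∧ |J2 t / W t| ≤ 3 / 7 ∧
      |(J2 t * deriv (deriv J1) t - J1 t * deriv (deriv J2) t) / W t| < 1 / 1216 ∧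
      |12 * g0 t + (deriv (deriv J2) t * deriv J1 t
          - deriv (deriv J1) t * deriv J2 t) / W t| < 1 / 492 := by
  intro t ht
  have hJ1 := abs_J1_lt ht
  have hJ2 := abs_J2_lt ht
  have hW := abs_W_sub_one_lt ht
  have hW0 : W t ≠ 0 := by
    intro h
    norm_num [h] at hW
  refine ⟨by linarith, by linarith, (abs_deriv_J1_lt ht).le, (abs_deriv_J2_lt ht).le, hW, hW0,
    (abs_div_lt_of_abs_sub_one_lt (by norm_num) hW (by linarith)).le,
    (abs_div_lt_of_abs_sub_one_lt (by norm_num) hW (by linarith)).le,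
    abs_div_lt_of_abs_sub_one_lt (by norm_num) hW ?_, ?_⟩
  · linarith [abs_cross_deriv_deriv_lt ht]
  · rw [← mul_div_cancel_right₀ (12 * g0 t) hW0, ← add_div]
    refine abs_div_lt_of_abs_sub_one_lt (by norm_num) hW ?_
    linarith [abs_g0_mul_W_add_cross_lt ht]
end

section
/- For all real numbers a₁, a₂ with |a₁| ≤ 1/290 and |a₂| ≤ 1/152, and every real t with −17/10 ≤ t ≤ 0, one has |a₁·J₁(t) + a₂·J₂(t)| < 1/180 and |a₁·J₁'(t) + a₂·J₂'(t)| < 1/90. -/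
/-- A linear combination with bounded coefficients is bounded by its values at the corners. -/
lemma abs_combination_lt {a b A B x y M : ℝ} (ha : |a| ≤ A) (hb : |b| ≤ B)
    (h₁ : A * x + B * y < M) (h₂ : A * x - B * y < M)
    (h₃ : -(A * x) + B * y < M) (h₄ : -(A * x) - B * y < M) :
    |a * x + b * y| < M := by
  have hx : |a * x| ≤ A * |x| := by
    rw [abs_mul]; exact mul_le_mul_of_nonneg_right ha (abs_nonneg x)
  have hy : |b * y| ≤ B * |y| := by
    rw [abs_mul]; exact mul_le_mul_of_nonneg_right hb (abs_nonneg y)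
  have h := abs_add_le (a * x) (b * y)
  rcases abs_choice x with ex | ex <;> rcases abs_choice y with ey | ey <;>
    rw [ex] at hx <;> rw [ey] at hy <;> linarith

/-- Bernstein basis polynomials (up to scaling) on `[l, u]` are nonnegative there. -/
lemma bernstein_basis_nonneg {l u s : ℝ} (hs : s ∈ Set.Icc l u) (i j : ℕ) :
    0 ≤ (s - l) ^ i * (u - s) ^ j :=
  mul_nonneg (pow_nonneg (sub_nonneg.2 hs.1) i) (pow_nonneg (sub_nonneg.2 hs.2) j)

/-- Bound for the combination of `J1` and `J2` in the variable `s`. -/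
lemma abs_polynomial_combination_lt {a₁ a₂ : ℝ}
    (h₁ : |a₁| ≤ 1 / 290) (h₂ : |a₂| ≤ 1 / 152) {s : ℝ}
    (hs : s ∈ Set.Icc (0 : ℝ) (17 / 10)) :
    |a₁ * (1 - (9489 / 2932) * s ^ 2 + (1350 / 4721) * s ^ 3 + (359 / 199) * s ^ 4
          - (1526 / 3719) * s ^ 5 - (708 / 1633) * s ^ 6 + (503 / 2201) * s ^ 7
          - (211 / 6486) * s ^ 8)
      + a₂ * (s - (48 / 659797) * s ^ 2 - (2941 / 2730) * s ^ 3 + (675 / 4873) * s ^ 4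
          + (1832 / 4745) * s ^ 5 - (2305 / 19401) * s ^ 6 - (677 / 14054) * s ^ 7
          + (1573 / 53783) * s ^ 8 - (531 / 128216) * s ^ 9)|
      < 1 / 180 := by
  rcases le_total s (4 / 5) with h | h
  · have hB := bernstein_basis_nonneg (l := 0) (u := 4 / 5) ⟨hs.1, h⟩
    apply abs_combination_lt h₁ h₂ <;>
      linarith [hB 0 9, hB 1 8, hB 2 7, hB 3 6, hB 4 5, hB 5 4, hB 6 3,
        hB 7 2, hB 8 1, hB 9 0]
  · have hB := bernstein_basis_nonneg (l := 4 / 5) (u := 17 / 10) ⟨h, hs.2⟩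
    apply abs_combination_lt h₁ h₂ <;>
      linarith [hB 0 9, hB 1 8, hB 2 7, hB 3 6, hB 4 5, hB 5 4, hB 6 3,
        hB 7 2, hB 8 1, hB 9 0]

/-- Bound for the combination of the derivatives of `J1` and `J2` in the variable `s`. -/
lemma abs_deriv_polynomial_combination_lt {a₁ a₂ : ℝ}
    (h₁ : |a₁| ≤ 1 / 290) (h₂ : |a₂| ≤ 1 / 152) {s : ℝ}
    (hs : s ∈ Set.Icc (0 : ℝ) (17 / 10)) :
    |a₁ * (-(9489 / 2932) * (2 * s) + (1350 / 4721) * (3 * s ^ 2) + (359 / 199) * (4 * s ^ 3)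
          - (1526 / 3719) * (5 * s ^ 4) - (708 / 1633) * (6 * s ^ 5)
          + (503 / 2201) * (7 * s ^ 6) - (211 / 6486) * (8 * s ^ 7))
      + a₂ * (1 - (48 / 659797) * (2 * s) - (2941 / 2730) * (3 * s ^ 2)
          + (675 / 4873) * (4 * s ^ 3)
          + (1832 / 4745) * (5 * s ^ 4) - (2305 / 19401) * (6 * s ^ 5)
          - (677 / 14054) * (7 * s ^ 6) + (1573 / 53783) * (8 * s ^ 7)
          - (531 / 128216) * (9 * s ^ 8))|
      < 1 / 90 := by
  rcases le_total s (1 / 2) with h | h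
  · have hB := bernstein_basis_nonneg (l := 0) (u := 1 / 2) ⟨hs.1, h⟩
    apply abs_combination_lt h₁ h₂ <;>
      linarith [hB 0 8, hB 1 7, hB 2 6, hB 3 5, hB 4 4, hB 5 3, hB 6 2,
        hB 7 1, hB 8 0]
  rcases le_total s 1 with h' | h'
  · have hB := bernstein_basis_nonneg (l := 1 / 2) (u := 1) ⟨h, h'⟩
    apply abs_combination_lt h₁ h₂ <;>
      linarith [hB 0 8, hB 1 7, hB 2 6, hB 3 5, hB 4 4, hB 5 3, hB 6 2,
        hB 7 1, hB 8 0]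
  · have hB := bernstein_basis_nonneg (l := 1) (u := 17 / 10) ⟨h', hs.2⟩
    apply abs_combination_lt h₁ h₂ <;>
      linarith [hB 0 8, hB 1 7, hB 2 6, hB 3 5, hB 4 4, hB 5 3, hB 6 2,
        hB 7 1, hB 8 0]

lemma hasDerivAt_J1 (t : ℝ) :
    HasDerivAt J1
      (-(9489 / 2932) * (2 * (t + 17 / 10)) + (1350 / 4721) * (3 * (t + 17 / 10) ^ 2)
      + (359 / 199) * (4 * (t + 17 / 10) ^ 3)
      - (1526 / 3719) * (5 * (t + 17 / 10) ^ 4) - (708 / 1633) * (6 * (t + 17 / 10) ^ 5)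
      + (503 / 2201) * (7 * (t + 17 / 10) ^ 6) - (211 / 6486) * (8 * (t + 17 / 10) ^ 7)) t := by
  have hs : HasDerivAt (fun x : ℝ => x + 17 / 10) 1 t := (hasDerivAt_id t).add_const _
  have hp (n : ℕ) (c : ℝ) := (hs.fun_pow n).const_mul c
  refine HasDerivAt.congr_deriv
    ((((((((hasDerivAt_const t (1 : ℝ)).fun_sub (hp 2 _)).fun_add (hp 3 _)).fun_add (hp 4 _)).fun_sub
      (hp 5 _)).fun_sub (hp 6 _)).fun_add (hp 7 _)).fun_sub (hp 8 _)) ?_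
  norm_num

lemma hasDerivAt_J2 (t : ℝ) :
    HasDerivAt J2
      (1 - (48 / 659797) * (2 * (t + 17 / 10)) - (2941 / 2730) * (3 * (t + 17 / 10) ^ 2)
      + (675 / 4873) * (4 * (t + 17 / 10) ^ 3)
      + (1832 / 4745) * (5 * (t + 17 / 10) ^ 4) - (2305 / 19401) * (6 * (t + 17 / 10) ^ 5)
      - (677 / 14054) * (7 * (t + 17 / 10) ^ 6) + (1573 / 53783) * (8 * (t + 17 / 10) ^ 7)
      - (531 / 128216) * (9 * (t + 17 / 10) ^ 8)) t := by
  have hs : HasDerivAt (fun x : ℝ => x + 17 / 10) 1 t := (hasDerivAt_id t).add_const _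
  have hp (n : ℕ) (c : ℝ) := (hs.fun_pow n).const_mul c
  refine HasDerivAt.congr_deriv
    ((((((((hs.fun_sub (hp 2 _)).fun_sub (hp 3 _)).fun_add (hp 4 _)).fun_add
      (hp 5 _)).fun_sub (hp 6 _)).fun_sub (hp 7 _)).fun_add (hp 8 _)).fun_sub (hp 9 _)) ?_
  norm_num

/-- **Proposition (estimate (eq:j1j2) of the paper).** For all `|a₁| ≤ 1/290`,
`|a₂| ≤ 1/152` and `t ∈ [−17/10, 0]`: `|a₁ J₁(t) + a₂ J₂(t)| < 1/180` and
`|a₁ J₁'(t) + a₂ J₂'(t)| < 1/90`. -/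
theorem linear_combination_estimates (a₁ a₂ : ℝ)
    (h₁ : |a₁| ≤ 1 / 290) (h₂ : |a₂| ≤ 1 / 152) :
    ∀ t ∈ Set.Icc (-17 / 10 : ℝ) 0,
      |a₁ * J1 t + a₂ * J2 t| < 1 / 180 ∧
      |a₁ * deriv J1 t + a₂ * deriv J2 t| < 1 / 90 := by
  intro t ht
  have hs : t + 17 / 10 ∈ Set.Icc (0 : ℝ) (17 / 10) :=
    ⟨by linarith [ht.1], by linarith [ht.2]⟩
  rw [(hasDerivAt_J1 t).deriv, (hasDerivAt_J2 t).deriv]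
  exact ⟨abs_polynomial_combination_lt h₁ h₂ hs, abs_deriv_polynomial_combination_lt h₁ h₂ hs⟩
end

section
/- Let g : [−17/10, 0] → ℝ be twice continuously differentiable with g''(t) = 6·g(t)² + t for all t ∈ [−17/10, 0]. If |g(−17/10) + 280/519| ≤ 1/290 and |g'(−17/10) − 150/1013| ≤ 1/152, then |g(0) + 87/469| < 1/167 and |g'(0) − 41/134| < 1/108. -/
open Set

/-- Evaluation at `x` of the polynomial with the given list of coefficients, lowest degree first. -/
noncomputable def horner : List ℝ → ℝ → ℝ
  | [], _ => 0
  | a :: l, x => a + x * horner l x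

/-- The derivative of `horner l`. -/
noncomputable def hornerDeriv : List ℝ → ℝ → ℝ
  | [], _ => 0
  | _ :: l, x => horner l x + x * hornerDeriv l x

/-- The second derivative of `horner l`. -/
noncomputable def hornerDeriv₂ : List ℝ → ℝ → ℝ
  | [], _ => 0
  | _ :: l, x => 2 * hornerDeriv l x + x * hornerDeriv₂ l x

theorem hasDerivAt_horner (l : List ℝ) (x : ℝ) : HasDerivAt (horner l) (hornerDeriv l x) x := by
  induction l with
  | nil => exact hasDerivAt_const x 0
  | cons a l ih =>
    refine (((hasDerivAt_id' x).mul ih).const_add a).congr_deriv ?_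
    rw [one_mul, hornerDeriv]

theorem hasDerivAt_hornerDeriv (l : List ℝ) (x : ℝ) :
    HasDerivAt (hornerDeriv l) (hornerDeriv₂ l x) x := by
  induction l with
  | nil => exact hasDerivAt_const x 0
  | cons a l ih =>
    refine ((hasDerivAt_horner l x).add ((hasDerivAt_id' x).mul ih)).congr_deriv ?_
    simp only [hornerDeriv₂]
    ring

theorem hasDerivAt_horner_affine (l : List ℝ) (c d t : ℝ) :
    HasDerivAt (fun s => horner l (c * s + d)) (c * hornerDeriv l (c * t + d)) t := by
  have h := (hasDerivAt_horner l (c * t + d)).comp t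
    (((hasDerivAt_id t).const_mul c).add_const d)
  simpa [Function.comp_def, mul_comm] using h

theorem hasDerivAt_hornerDeriv_affine (l : List ℝ) (c d t : ℝ) :
    HasDerivAt (fun s => c * hornerDeriv l (c * s + d))
      (c ^ 2 * hornerDeriv₂ l (c * t + d)) t := by
  have h := ((hasDerivAt_hornerDeriv l (c * t + d)).comp t
    (((hasDerivAt_id t).const_mul c).add_const d)).const_mul c
  refine h.congr_deriv ?_
  ring

/-- A one-sided mean value inequality on `[a, τ] ⊆ [a, b]`. -/
theorem sub_le_of_hasDerivWithinAt_le {a b τ C : ℝ} {f f' : ℝ → ℝ}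
    (hf : ∀ t ∈ Icc a b, HasDerivWithinAt f (f' t) (Icc a b) t) (hτ : τ ∈ Icc a b)
    (hC : ∀ t ∈ Ico a τ, f' t ≤ C) : f τ - f a ≤ C * (τ - a) := by
  have hsub : Icc a τ ⊆ Icc a b := Icc_subset_Icc_right hτ.2
  have hd : ∀ t ∈ Ioo a τ, HasDerivAt f (f' t) t := fun t ht =>
    (hf t (hsub (Ioo_subset_Icc_self ht))).hasDerivAt
      (Icc_mem_nhds ht.1 (ht.2.trans_le hτ.2))
  refine (convex_Icc a τ).image_sub_le_mul_sub_of_deriv_le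
    (fun t ht => ((hf t (hsub ht)).mono hsub).continuousWithinAt) ?_ ?_
    a (left_mem_Icc.2 hτ.1) τ (right_mem_Icc.2 hτ.1) hτ.1
  · rw [interior_Icc]
    exact fun t ht => (hd t ht).differentiableAt.differentiableWithinAt
  · rw [interior_Icc]
    intro t ht
    rw [(hd t ht).deriv]
    exact hC t (Ioo_subset_Ico_self ht)

/-- Two-sided form of `sub_le_of_hasDerivWithinAt_le` on the whole interval. -/
theorem abs_sub_le_of_hasDerivWithinAt_le {a b C : ℝ} {f f' : ℝ → ℝ} (hab : a ≤ b)
    (hf : ∀ t ∈ Icc a b, HasDerivWithinAt f (f' t) (Icc a b) t)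
    (hC : ∀ t ∈ Icc a b, |f' t| ≤ C) : |f b - f a| ≤ C * (b - a) := by
  have h₁ := sub_le_of_hasDerivWithinAt_le hf (right_mem_Icc.2 hab)
    fun t ht => (abs_le.1 (hC t (Ico_subset_Icc_self ht))).2
  have h₂ := sub_le_of_hasDerivWithinAt_le (f := fun t => -f t) (C := C)
    (fun t ht => (hf t ht).fun_neg) (right_mem_Icc.2 hab)
    fun t ht => neg_le.1 (abs_le.1 (hC t (Ico_subset_Icc_self ht))).1
  exact abs_le.2 ⟨by linarith, h₁⟩

/-- A priori bounds for `e'' = 12 p e + 6 e² - r` with `p` negative and increasing, obtained from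
the energy `e'² - 12 p e²` by continuation. -/
theorem abs_lt_of_energy_lt {a b E E' ρ m : ℝ} {e e' p p' r : ℝ → ℝ}
    (hE : 0 < E) (hE' : 0 < E') (hm : 0 ≤ m)
    (he : ∀ t ∈ Icc a b, HasDerivWithinAt e (e' t) (Icc a b) t)
    (he' : ∀ t ∈ Icc a b,
      HasDerivWithinAt e' (12 * p t * e t + 6 * e t ^ 2 - r t) (Icc a b) t)
    (hp : ∀ t ∈ Icc a b, HasDerivWithinAt p (p' t) (Icc a b) t)
    (hpm : ∀ t ∈ Icc a b, p t ≤ -m) (hp' : ∀ t ∈ Icc a b, 0 ≤ p' t)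
    (hr : ∀ t ∈ Icc a b, |r t| ≤ ρ)
    (hi : e' a ^ 2 - 12 * p a * e a ^ 2 + 2 * E' * (6 * E ^ 2 + ρ) * (b - a) < E' ^ 2)
    (hi' : e' a ^ 2 - 12 * p a * e a ^ 2 + 2 * E' * (6 * E ^ 2 + ρ) * (b - a)
      < 12 * m * E ^ 2) :
    ∀ t ∈ Icc a b, |e t| < E ∧ |e' t| < E' := by
  have hW : ∀ t ∈ Icc a b, HasDerivWithinAt (fun s => e' s ^ 2 - 12 * p s * e s ^ 2)
      (2 * e' t * (6 * e t ^ 2 - r t) - 12 * p' t * e t ^ 2) (Icc a b) t := by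
    intro t ht
    have h := ((he' t ht).fun_pow 2).fun_sub
      (((hp t ht).const_mul 12).fun_mul ((he t ht).fun_pow 2))
    refine h.congr_deriv ?_
    norm_num
    ring
  have step : ∀ τ ∈ Icc a b, (∀ s ∈ Ico a τ, |e s| < E ∧ |e' s| < E') →
      |e τ| < E ∧ |e' τ| < E' := by
    intro τ hτ h
    have hab : a ∈ Icc a b := left_mem_Icc.2 (hτ.1.trans hτ.2)
    have hρ : 0 ≤ ρ := (abs_nonneg _).trans (hr a hab)
    have hle := sub_le_of_hasDerivWithinAt_le hW hτ (C := 2 * E' * (6 * E ^ 2 + ρ)) (by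
      intro t ht
      have ht' : t ∈ Icc a b := ⟨ht.1, ht.2.le.trans hτ.2⟩
      obtain ⟨h₁, h₂⟩ := h t ht
      have h₃ : e t ^ 2 ≤ E ^ 2 := sq_le_sq' (abs_lt.1 h₁).1.le (abs_lt.1 h₁).2.le
      have h₄ : |6 * e t ^ 2 - r t| ≤ 6 * E ^ 2 + ρ := by
        have := abs_le.1 (hr t ht')
        exact abs_le.2 ⟨by nlinarith [sq_nonneg (e t)], by linarith⟩
      have h₅ : e' t * (6 * e t ^ 2 - r t) ≤ E' * (6 * E ^ 2 + ρ) :=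
        (le_abs_self _).trans (by rw [abs_mul]; gcongr)
      have h₆ := mul_nonneg (hp' t ht') (sq_nonneg (e t))
      linarith)
    have hmul : 2 * E' * (6 * E ^ 2 + ρ) * (τ - a) ≤ 2 * E' * (6 * E ^ 2 + ρ) * (b - a) := by
      gcongr
      exact hτ.2
    have hpe : m * e τ ^ 2 ≤ -p τ * e τ ^ 2 := by
      gcongr
      linarith [hpm τ hτ]
    have hme := mul_nonneg hm (sq_nonneg (e τ))
    constructor
    · refine abs_lt_of_sq_lt_sq ?_ hE.le
      refine lt_of_mul_lt_mul_left (?_ : m * e τ ^ 2 < m * E ^ 2) hm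
      linarith [sq_nonneg (e' τ)]
    · refine abs_lt_of_sq_lt_sq ?_ hE'.le
      linarith
  by_contra! hcon
  have hce : ContinuousOn e (Icc a b) := fun t ht => (he t ht).continuousWithinAt
  have hce' : ContinuousOn e' (Icc a b) := fun t ht => (he' t ht).continuousWithinAt
  have hcl : IsClosed ((Icc a b ∩ (fun t => |e t|) ⁻¹' Ici E) ∪
      (Icc a b ∩ (fun t => |e' t|) ⁻¹' Ici E')) :=
    (hce.abs.preimage_isClosed_of_isClosed isClosed_Icc isClosed_Ici).union
      (hce'.abs.preimage_isClosed_of_isClosed isClosed_Icc isClosed_Ici)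
  rw [← inter_union_distrib_left] at hcl
  have hK := isCompact_Icc.of_isClosed_subset hcl inter_subset_left
  obtain ⟨t, ht, hbad⟩ := hcon
  obtain ⟨τ, ⟨hτ, hτE⟩, hmin⟩ := hK.exists_isLeast ⟨t, ht, by
    by_cases h : |e t| < E
    · exact Or.inr (hbad h)
    · exact Or.inl (not_lt.1 h)⟩
  obtain ⟨h₁, h₂⟩ := step τ hτ (by
    intro s hs
    by_contra h
    refine hs.2.not_ge (hmin ⟨⟨hs.1, hs.2.le.trans hτ.2⟩, ?_⟩)
    rcases not_and_or.1 h with h | h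
    · exact Or.inl (not_lt.1 h)
    · exact Or.inr (not_lt.1 h))
  rcases hτE with h | h
  · exact h₁.not_ge h
  · exact h₂.not_ge h

/-- The Wronskian of a small solution of `e'' = 12 p e + 6 e² - r` and an approximate solution `ψ`
of the linearised equation `ψ'' = 12 p ψ` is almost constant. -/
theorem abs_wronskian_sub_le {a b E ρ M σ : ℝ} {e e' p r ψ ψ' ψ'' : ℝ → ℝ} (hab : a ≤ b)
    (he : ∀ t ∈ Icc a b, HasDerivWithinAt e (e' t) (Icc a b) t)
    (he' : ∀ t ∈ Icc a b,
      HasDerivWithinAt e' (12 * p t * e t + 6 * e t ^ 2 - r t) (Icc a b) t)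
    (hψ : ∀ t ∈ Icc a b, HasDerivWithinAt ψ (ψ' t) (Icc a b) t)
    (hψ' : ∀ t ∈ Icc a b, HasDerivWithinAt ψ' (ψ'' t) (Icc a b) t)
    (hE : ∀ t ∈ Icc a b, |e t| ≤ E) (hr : ∀ t ∈ Icc a b, |r t| ≤ ρ)
    (hM : ∀ t ∈ Icc a b, |ψ t| ≤ M)
    (hσ : ∀ t ∈ Icc a b, |12 * p t * ψ t - ψ'' t| ≤ σ) :
    |(e' b * ψ b - e b * ψ' b) - (e' a * ψ a - e a * ψ' a)|
      ≤ ((6 * E ^ 2 + ρ) * M + E * σ) * (b - a) := by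
  refine abs_sub_le_of_hasDerivWithinAt_le (f := fun t => e' t * ψ t - e t * ψ' t)
    (f' := fun t => (6 * e t ^ 2 - r t) * ψ t + e t * (12 * p t * ψ t - ψ'' t)) hab ?_ ?_
  · intro t ht
    refine (((he' t ht).fun_mul (hψ t ht)).fun_sub
      ((he t ht).fun_mul (hψ' t ht))).congr_deriv ?_
    ring
  · intro t ht
    have hE₀ : 0 ≤ E := (abs_nonneg _).trans (hE t ht)
    have h₃ : e t ^ 2 ≤ E ^ 2 := sq_le_sq' (abs_le.1 (hE t ht)).1 (abs_le.1 (hE t ht)).2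
    have h₄ : |6 * e t ^ 2 - r t| ≤ 6 * E ^ 2 + ρ := by
      have := abs_le.1 (hr t ht)
      exact abs_le.2 ⟨by nlinarith [sq_nonneg (e t)], by linarith⟩
    have hEρ : 0 ≤ 6 * E ^ 2 + ρ := (abs_nonneg _).trans h₄
    refine (abs_add_le _ _).trans ?_
    rw [abs_mul, abs_mul]
    gcongr
    exacts [hM t ht, hE t ht, hσ t ht]

/-- Coefficients in `x = 20 t / 17 + 1` of an approximate solution of `g'' = 6 g² + t`. -/
noncomputable def refCoeffs : List ℝ :=
  [-3932376 / 10 ^ 7, 1702137 / 10 ^ 7, 281106 / 10 ^ 7, 56339 / 10 ^ 7, 24798 / 10 ^ 7,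
    11138 / 10 ^ 7, 1095 / 10 ^ 7, 294 / 10 ^ 7, 359 / 10 ^ 7, 63 / 10 ^ 7, 3 / 10 ^ 7,
    6 / 10 ^ 7]

/-- Coefficients in `x = 20 t / 17 + 1` of an approximate solution of the linearised equation with
value `0` and derivative `-1` at `t = 0`. -/
noncomputable def linCoeffs₁ : List ℝ :=
  [528036 / 10 ^ 6, 126237 / 10 ^ 6, -900135 / 10 ^ 6, 58144 / 10 ^ 6, 281990 / 10 ^ 6,
    -73503 / 10 ^ 6, -35915 / 10 ^ 6, 15351 / 10 ^ 6, 1213 / 10 ^ 6, -1620 / 10 ^ 6,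
    135 / 10 ^ 6, 94 / 10 ^ 6, -25 / 10 ^ 6]

/-- Coefficients in `x = 20 t / 17 + 1` of an approximate solution of the linearised equation with
value `1` and derivative `0` at `t = 0`. -/
noncomputable def linCoeffs₂ : List ℝ :=
  [79001 / 10 ^ 6, 1628625 / 10 ^ 6, -134673 / 10 ^ 6, -906000 / 10 ^ 6, 240154 / 10 ^ 6,
    164546 / 10 ^ 6, -70246 / 10 ^ 6, -9481 / 10 ^ 6, 9098 / 10 ^ 6, -538 / 10 ^ 6,
    -637 / 10 ^ 6, 136 / 10 ^ 6, 25 / 10 ^ 6]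

theorem abs_pow_le_one {x : ℝ} (hx : |x| ≤ 1) (n : ℕ) : -1 ≤ x ^ n ∧ x ^ n ≤ 1 := by
  rw [← abs_le, abs_pow]
  exact pow_le_one₀ (abs_nonneg x) hx

theorem horner_refCoeffs_le {x : ℝ} (hx : |x| ≤ 1) : horner refCoeffs x ≤ -(185 / 1000) := by
  have h := abs_pow_le_one hx
  simp only [refCoeffs, horner]
  linarith [(h 1).2, (h 2).2, (h 3).2, (h 4).2, (h 5).2, (h 6).2, (h 7).2, (h 8).2, (h 9).2,
    (h 10).2, (h 11).2]

theorem hornerDeriv_refCoeffs_nonneg {x : ℝ} (hx : |x| ≤ 1) : 0 ≤ hornerDeriv refCoeffs x := by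
  have h := abs_pow_le_one hx
  simp only [refCoeffs, hornerDeriv, horner]
  linarith [(h 1).1, (h 2).1, (h 3).1, (h 4).1, (h 5).1, (h 6).1, (h 7).1, (h 8).1, (h 9).1,
    (h 10).1]

theorem abs_residual_refCoeffs_le {x : ℝ} (hx : |x| ≤ 1) :
    |(20 / 17) ^ 2 * hornerDeriv₂ refCoeffs x - 6 * horner refCoeffs x ^ 2 - 17 / 20 * (x - 1)|
      ≤ 6 / 10 ^ 5 := by
  have h := abs_pow_le_one hx
  simp only [refCoeffs, hornerDeriv₂, hornerDeriv, horner]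
  rw [abs_le]
  constructor <;> ring_nf <;>
  linarith [h 1, h 2, h 3, h 4, h 5, h 6, h 7, h 8, h 9, h 10, h 11, h 12, h 13, h 14, h 15, h 16,
    h 17, h 18, h 19, h 20, h 21, h 22]

theorem abs_residual_linCoeffs₁_le {x : ℝ} (hx : |x| ≤ 1) :
    |12 * horner refCoeffs x * horner linCoeffs₁ x
      - (20 / 17) ^ 2 * hornerDeriv₂ linCoeffs₁ x| ≤ 16 / 10 ^ 4 := by
  have h := abs_pow_le_one hx
  simp only [refCoeffs, linCoeffs₁, hornerDeriv₂, hornerDeriv, horner]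
  rw [abs_le]
  constructor <;> ring_nf <;>
  linarith [h 1, h 2, h 3, h 4, h 5, h 6, h 7, h 8, h 9, h 10, h 11, h 12, h 13, h 14, h 15, h 16,
    h 17, h 18, h 19, h 20, h 21, h 22, h 23]

theorem abs_residual_linCoeffs₂_le {x : ℝ} (hx : |x| ≤ 1) :
    |12 * horner refCoeffs x * horner linCoeffs₂ x
      - (20 / 17) ^ 2 * hornerDeriv₂ linCoeffs₂ x| ≤ 36 / 10 ^ 4 := by
  have h := abs_pow_le_one hx
  simp only [refCoeffs, linCoeffs₂, hornerDeriv₂, hornerDeriv, horner]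
  rw [abs_le]
  constructor <;> ring_nf <;>
  linarith [h 1, h 2, h 3, h 4, h 5, h 6, h 7, h 8, h 9, h 10, h 11, h 12, h 13, h 14, h 15, h 16,
    h 17, h 18, h 19, h 20, h 21, h 22, h 23]

theorem abs_horner_linCoeffs₁_le {x : ℝ} (hx : |x| ≤ 1) :
    |horner linCoeffs₁ x| ≤ 65 / 100 := by
  have h := abs_pow_le_one hx
  have h₂ : x ^ 2 ≤ 1 := (h 2).2
  have h₃ : x ^ 3 ≤ x ^ 2 := by nlinarith [mul_le_mul_of_nonneg_right (h 1).2 (sq_nonneg x)]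
  have h₄' : 0 ≤ x ^ 2 * (1 - x ^ 2) := mul_nonneg (sq_nonneg x) (by linarith)
  simp only [linCoeffs₁, horner]
  rw [abs_le]
  constructor <;> ring_nf <;>
  nlinarith [h 1, h 2, h 3, h 4, h 5, h 6, h 7, h 8, h 9, h 10, h 11, h 12, sq_nonneg (x - 1 / 6)]

theorem abs_horner_linCoeffs₂_le {x : ℝ} (hx : |x| ≤ 1) :
    |horner linCoeffs₂ x| ≤ 16 / 10 := by
  have h := abs_pow_le_one hx
  have h₁ := abs_le.1 hx
  have h₃ : 0 ≤ (x - 4 / 5) ^ 2 * (x + 8 / 5) := mul_nonneg (sq_nonneg _) (by linarith)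
  have h₃' : 0 ≤ (x + 4 / 5) ^ 2 * (8 / 5 - x) := mul_nonneg (sq_nonneg _) (by linarith)
  have h₄ : 0 ≤ x ^ 2 * (1 - x ^ 2) := mul_nonneg (sq_nonneg _) (by linarith [(h 2).2])
  simp only [linCoeffs₂, horner]
  rw [abs_le]
  constructor <;> ring_nf <;>
  linarith [h 1, h 2, h 3, h 4, h 5, h 6, h 7, h 8, h 9, h 10, h 11, h 12, sq_nonneg (x ^ 2),
    sq_nonneg (x ^ 3)]

/-- **Proposition (transfer of bounds from `t = −17/10` to `t = 0`).** Any twice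
continuously differentiable real solution of `g'' = 6g² + t` on `[−17/10, 0]` with
`|g(−17/10) + 280/519| ≤ 1/290` and `|g'(−17/10) − 150/1013| ≤ 1/152` satisfies
`|g(0) + 87/469| < 1/167` and `|g'(0) − 41/134| < 1/108`. -/
theorem tritronquee_value_at_zero (g : ℝ → ℝ)
    (hg : ContDiffOn ℝ 2 g (Set.Icc (-17 / 10 : ℝ) 0))
    (hode : ∀ t ∈ Set.Icc (-17 / 10 : ℝ) 0,
      derivWithin (derivWithin g (Set.Icc (-17 / 10 : ℝ) 0)) (Set.Icc (-17 / 10 : ℝ) 0) t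
        = 6 * (g t) ^ 2 + t)
    (h1 : |g (-17 / 10) + 280 / 519| ≤ 1 / 290)
    (h2 : |derivWithin g (Set.Icc (-17 / 10 : ℝ) 0) (-17 / 10) - 150 / 1013| ≤ 1 / 152) :
    |g 0 + 87 / 469| < 1 / 167 ∧
    |derivWithin g (Set.Icc (-17 / 10 : ℝ) 0) 0 - 41 / 134| < 1 / 108 := by
  set I := Icc (-17 / 10 : ℝ) 0
  have hab : (-17 / 10 : ℝ) ≤ 0 := by norm_num
  have hu : UniqueDiffOn ℝ I := uniqueDiffOn_Icc (by norm_num)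
  have hx : ∀ t ∈ I, |20 / 17 * t + 1| ≤ 1 := fun t ht =>
    abs_le.2 ⟨by linarith [ht.1], by linarith [ht.2]⟩
  have hcoeff : ∀ (l : List ℝ) (t : ℝ), HasDerivWithinAt (fun s => horner l (20 / 17 * s + 1))
      (20 / 17 * hornerDeriv l (20 / 17 * t + 1)) I t := fun l t =>
    (hasDerivAt_horner_affine l _ _ t).hasDerivWithinAt
  have hcoeff' : ∀ (l : List ℝ) (t : ℝ),
      HasDerivWithinAt (fun s => 20 / 17 * hornerDeriv l (20 / 17 * s + 1))
        ((20 / 17) ^ 2 * hornerDeriv₂ l (20 / 17 * t + 1)) I t := fun l t =>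
    (hasDerivAt_hornerDeriv_affine l _ _ t).hasDerivWithinAt
  have hg' : ∀ t ∈ I, HasDerivWithinAt g (derivWithin g I t) I t := fun t ht =>
    (hg.differentiableOn (by norm_num) t ht).hasDerivWithinAt
  have hg'' : ∀ t ∈ I, HasDerivWithinAt (derivWithin g I) (6 * g t ^ 2 + t) I t := by
    intro t ht
    rw [← hode t ht]
    exact ((hg.derivWithin hu (m := 1) (by norm_num)).differentiableOn (by norm_num)
      t ht).hasDerivWithinAt
  set p : ℝ → ℝ := fun t => horner refCoeffs (20 / 17 * t + 1) with hp
  set p' : ℝ → ℝ := fun t => 20 / 17 * hornerDeriv refCoeffs (20 / 17 * t + 1) with hp'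
  set r : ℝ → ℝ := fun t => (20 / 17) ^ 2 * hornerDeriv₂ refCoeffs (20 / 17 * t + 1)
    - 6 * horner refCoeffs (20 / 17 * t + 1) ^ 2 - 17 / 20 * (20 / 17 * t + 1 - 1) with hr
  set e : ℝ → ℝ := fun t => g t - p t with he
  set e' : ℝ → ℝ := fun t => derivWithin g I t - p' t with he'
  have hde : ∀ t ∈ I, HasDerivWithinAt e (e' t) I t := fun t ht =>
    (hg' t ht).fun_sub (hcoeff refCoeffs t)
  have hde' : ∀ t ∈ I, HasDerivWithinAt e' (12 * p t * e t + 6 * e t ^ 2 - r t) I t := by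
    intro t ht
    refine ((hg'' t ht).fun_sub (hcoeff' refCoeffs t)).congr_deriv ?_
    simp only [hp, hr, he]
    ring
  have hrρ : ∀ t ∈ I, |r t| ≤ 6 / 10 ^ 5 := fun t ht => abs_residual_refCoeffs_le (hx t ht)
  have hpa : p (-17 / 10) = -337187 / 625000 := by
    norm_num [hp, horner, refCoeffs]
  have hpb : p 0 = -1855038 / 10 ^ 7 := by
    norm_num [hp, horner, refCoeffs]
  have hp'a : p' (-17 / 10) = 1258659 / 8500000 := by
    norm_num [hp', horner, hornerDeriv, refCoeffs]
  have hp'b : p' 0 = 2600411 / 8500000 := by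
    norm_num [hp', horner, hornerDeriv, refCoeffs]
  have hea : |e (-17 / 10)| ≤ 345 / 10 ^ 5 := by
    simp only [he, hpa]
    rw [abs_le] at h1 ⊢
    constructor <;> linarith
  have he'a : |e' (-17 / 10)| ≤ 6582 / 10 ^ 6 := by
    simp only [he', hp'a]
    rw [abs_le] at h2 ⊢
    constructor <;> linarith
  have hea₂ : e (-17 / 10) ^ 2 ≤ (345 / 10 ^ 5) ^ 2 := sq_le_sq.2 (by
    rwa [abs_of_pos (by norm_num : (0 : ℝ) < 345 / 10 ^ 5)])
  have he'a₂ : e' (-17 / 10) ^ 2 ≤ (6582 / 10 ^ 6) ^ 2 := sq_le_sq.2 (by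
    rwa [abs_of_pos (by norm_num : (0 : ℝ) < 6582 / 10 ^ 6)])
  have hbound : ∀ t ∈ I, |e t| < 82 / 10 ^ 4 ∧ |e' t| < 122 / 10 ^ 4 := by
    refine abs_lt_of_energy_lt (m := 185 / 1000) (by norm_num) (by norm_num) (by norm_num)
      hde hde' (fun t _ => hcoeff refCoeffs t) (fun t ht => horner_refCoeffs_le (hx t ht))
      (fun t ht => mul_nonneg (by norm_num) (hornerDeriv_refCoeffs_nonneg (hx t ht)))
      hrρ ?_ ?_ <;>
    · rw [hpa]
      linarith
  have hE : ∀ t ∈ I, |e t| ≤ 82 / 10 ^ 4 := fun t ht => (hbound t ht).1.le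
  have hw : ∀ (l : List ℝ) (M σ : ℝ), (∀ x, |x| ≤ 1 → |horner l x| ≤ M) →
      (∀ x, |x| ≤ 1 → |12 * horner refCoeffs x * horner l x
        - (20 / 17) ^ 2 * hornerDeriv₂ l x| ≤ σ) →
      |(e' 0 * horner l 1 - e 0 * (20 / 17 * hornerDeriv l 1))
        - (e' (-17 / 10) * horner l (-1) - e (-17 / 10) * (20 / 17 * hornerDeriv l (-1)))|
      ≤ ((6 * (82 / 10 ^ 4) ^ 2 + 6 / 10 ^ 5) * M + 82 / 10 ^ 4 * σ) * (17 / 10) := by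
    intro l M σ hM hσ
    have h := abs_wronskian_sub_le hab hde hde' (fun t _ => hcoeff l t) (fun t _ => hcoeff' l t)
      hE hrρ (fun t ht => hM _ (hx t ht)) (fun t ht => hσ _ (hx t ht))
    norm_num at h ⊢
    exact h
  have hw₁ := hw linCoeffs₁ _ _ (fun _ => abs_horner_linCoeffs₁_le)
    fun _ => abs_residual_linCoeffs₁_le
  have hw₂ := hw linCoeffs₂ _ _ (fun _ => abs_horner_linCoeffs₂_le)
    fun _ => abs_residual_linCoeffs₂_le
  obtain ⟨hb, hb'⟩ := hbound 0 (right_mem_Icc.2 hab)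
  have hg0 : g 0 = e 0 + p 0 := by simp only [he]; ring
  have hg'0 : derivWithin g I 0 = e' 0 + p' 0 := by simp only [he']; ring
  rw [hg0, hg'0, hpb, hp'b]
  norm_num [horner, hornerDeriv, linCoeffs₁] at hw₁
  norm_num [horner, hornerDeriv, linCoeffs₂] at hw₂
  rw [abs_le] at hw₁ hw₂ hea he'a
  rw [abs_lt] at hb hb'
  constructor <;> rw [abs_lt] <;> constructor <;> linarith
end
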